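/- There is an absolute constant C such that the following holds. For every list coloring instance on a simple graph G with n ≥ 2 vertices in which every list L(v) has at most n colors, and every path decomposition of G of width p, there exists a CNF formula ψ with at most C·n³ variables and clauses, together with a path decomposition of ψ of width at most (p + 1)·⌈log₂ n⌉, such that ψ is satisfiable if and only if the instance admits a proper list coloring. -/

import Mathlib

open scoped Classical

namespace PPSETH

abbrev Var := ℕ
abbrev Clause := Finset (Var × Bool)
abbrev CNF := List Clause

/-- The set of variables occurring in a clause. -/
def clauseVars (c : Clause) : Finset Var := c.image Prod.fst

/-- The set of variables occurring in a CNF formula. -/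
def cnfVars (φ : CNF) : Finset Var := φ.foldr (fun c s => clauseVars c ∪ s) ∅

/-- An assignment satisfies a clause if the clause contains a literal it makes true. -/
def SatC (τ : Var → Bool) (c : Clause) : Prop := ∃ l ∈ c, τ l.1 = l.2

/-- An assignment satisfies a CNF formula if it satisfies every clause. -/
def Sat (τ : Var → Bool) (φ : CNF) : Prop := ∀ c ∈ φ, SatC τ c

def Satisfiable (φ : CNF) : Prop := ∃ τ, Sat τ φ

/-- Size of a CNF formula: number of variables plus total number of literal occurrences. -/
def size (φ : CNF) : ℕ := (cnfVars φ).card + (φ.map Finset.card).sum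

/-- Weight of an assignment: the number of variables of the formula set to true. -/
def weight (φ : CNF) (τ : Var → Bool) : ℕ :=
  ((cnfVars φ).filter (fun x => τ x = true)).card

/-- The number of clauses (with multiplicity) satisfied by an assignment. -/
noncomputable def satCount (φ : CNF) (τ : Var → Bool) : ℕ :=
  (φ.map (fun c => if SatC τ c then 1 else 0)).sum

/-- Number of clauses (with multiplicity) in which a variable occurs. -/
noncomputable def occs (φ : CNF) (x : Var) : ℕ :=
  (φ.map (fun c => if x ∈ clauseVars c then 1 else 0)).sum

/-- A k-CNF formula: every clause has at most k literals. -/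
def IsKCNF (k : ℕ) (φ : CNF) : Prop := ∀ c ∈ φ, c.card ≤ k

/-- Structural conditions for a path decomposition of (the primal graph of) a CNF formula. -/
def PDOn (φ : CNF) (B : List (Finset Var)) : Prop :=
  (∀ b ∈ B, b ⊆ cnfVars φ) ∧
  (∀ x ∈ cnfVars φ, ∃ b ∈ B, x ∈ b) ∧
  (∀ c ∈ φ, ∃ b ∈ B, clauseVars c ⊆ b) ∧
  (∀ x : Var, ∀ i j k : ℕ, i ≤ j → j ≤ k →
    x ∈ B.getD i ∅ → x ∈ B.getD k ∅ → x ∈ B.getD j ∅)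

/-- A path decomposition of a CNF formula of width `p`: bags have size at most `p + 1`. -/
def PD (φ : CNF) (p : ℕ) (B : List (Finset Var)) : Prop :=
  PDOn φ B ∧ ∀ b ∈ B, b.card ≤ p + 1


/-- A path decomposition of a simple graph of width `p`: a list of bags of vertices, each
of size at most `p + 1`, covering every vertex, containing both endpoints of every edge
in some bag, with each vertex occurring in an interval of bags. -/
def GraphPD {V : Type*} (G : SimpleGraph V) (p : ℕ) (Bs : List (Finset V)) : Prop :=
  (∀ b ∈ Bs, b.card ≤ p + 1) ∧
  (∀ v : V, ∃ b ∈ Bs, v ∈ b) ∧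
  (∀ u v : V, G.Adj u v → ∃ b ∈ Bs, u ∈ b ∧ v ∈ b) ∧
  (∀ v : V, ∀ i j k : ℕ, i ≤ j → j ≤ k →
    v ∈ Bs.getD i ∅ → v ∈ Bs.getD k ∅ → v ∈ Bs.getD j ∅)

lemma mem_cnfVars {φ : CNF} {x : Var} : x ∈ cnfVars φ ↔ ∃ c ∈ φ, x ∈ clauseVars c := by
  induction φ with
  | nil => simp [cnfVars]
  | cons c φ ih =>
    have h : cnfVars (c :: φ) = clauseVars c ∪ cnfVars φ := rfl
    simp [h, ih]

/-- The clause stating that the variables `f j` do not carry the bit pattern `t`. -/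
def forbid {k : ℕ} (f : Fin k → Var) (t : Fin k → Bool) : Clause :=
  Finset.univ.image fun j => (f j, !t j)

lemma satC_forbid {k : ℕ} (τ : Var → Bool) (f : Fin k → Var) (t : Fin k → Bool) :
    SatC τ (forbid f t) ↔ (fun j => τ (f j)) ≠ t := by
  simp [SatC, forbid, Function.ne_iff, Bool.eq_not]

lemma satC_union (τ : Var → Bool) (c d : Clause) :
    SatC τ (c ∪ d) ↔ SatC τ c ∨ SatC τ d := by
  simp only [SatC, Finset.mem_union, or_and_right, exists_or]

lemma clauseVars_union (c d : Clause) : clauseVars (c ∪ d) = clauseVars c ∪ clauseVars d :=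
  Finset.image_union _ _

lemma clauseVars_forbid {k : ℕ} (f : Fin k → Var) (t : Fin k → Bool) :
    clauseVars (forbid f t) = Finset.univ.image f := by
  simp only [clauseVars, forbid, Finset.image_image]
  rfl

lemma exists_injOn_bits (s : Finset ℕ) (k : ℕ) (h : s.card ≤ 2 ^ k) :
    ∃ e : ℕ → Fin k → Bool, Set.InjOn e s := by
  have hc : Fintype.card s ≤ Fintype.card (Fin k → Bool) := by simpa using h
  obtain ⟨e⟩ := Function.Embedding.nonempty_of_card_le hc
  refine ⟨fun a => if ha : a ∈ s then e ⟨a, ha⟩ else fun _ => false, ?_⟩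
  intro a ha b hb hab
  rw [Finset.mem_coe] at ha hb
  simpa [ha, hb] using hab

lemma two_pow_clog_le {n : ℕ} (hn : 2 ≤ n) : 2 ^ Nat.clog 2 n ≤ 2 * n := by
  have h := Nat.pow_pred_clog_lt_self (b := 2) (by norm_num) hn
  have hpos : 0 < Nat.clog 2 n := Nat.clog_pos (by norm_num) hn
  obtain ⟨m, hm⟩ := Nat.exists_eq_succ_of_ne_zero hpos.ne'
  rw [hm] at h ⊢
  rw [Nat.pred_succ] at h
  rw [pow_succ]
  lia

section Coloring

variable {V : Type} [Fintype V] {k : ℕ}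

/-- The clauses forbidding bit patterns at `v` that encode no color of `L v`. -/
noncomputable def listClauses (L : V → Finset ℕ) (f : V × Fin k → Var)
    (enc : V → ℕ → Fin k → Bool) : Finset Clause :=
  Finset.univ.biUnion fun v =>
    (Finset.univ \ (L v).image (enc v)).image (forbid fun j => f (v, j))

/-- The clauses forbidding that two adjacent vertices both encode the same color. -/
noncomputable def edgeClauses (G : SimpleGraph V) (L : V → Finset ℕ) (f : V × Fin k → Var)
    (enc : V → ℕ → Fin k → Bool) : Finset Clause :=
  Finset.univ.biUnion fun u => Finset.univ.biUnion fun v =>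
    if G.Adj u v then (L u ∩ L v).image fun a =>
      forbid (fun j => f (u, j)) (enc u a) ∪ forbid (fun j => f (v, j)) (enc v a)
    else ∅

/-- The CNF formula encoding the list coloring instance `(G, L)` with `k` bits per vertex. -/
noncomputable def coloringCNF (G : SimpleGraph V) (L : V → Finset ℕ) (f : V × Fin k → Var)
    (enc : V → ℕ → Fin k → Bool) : CNF :=
  (listClauses L f enc ∪ edgeClauses G L f enc).toList

/-- The variables encoding the color of `v`. -/
def block (f : V × Fin k → Var) (v : V) : Finset Var :=
  Finset.univ.image fun j => f (v, j)

variable {G : SimpleGraph V} {L : V → Finset ℕ} {f : V × Fin k → Var}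
  {enc : V → ℕ → Fin k → Bool}

lemma mem_coloringCNF {c : Clause} : c ∈ coloringCNF G L f enc ↔
    (∃ v t, t ∉ (L v).image (enc v) ∧ forbid (fun j => f (v, j)) t = c) ∨
    ∃ u v a, G.Adj u v ∧ a ∈ L u ∧ a ∈ L v ∧
      forbid (fun j => f (u, j)) (enc u a) ∪ forbid (fun j => f (v, j)) (enc v a) = c := by
  rw [coloringCNF, Finset.mem_toList, Finset.mem_union]
  refine or_congr ?_ ?_
  · simp [listClauses]
  · simp only [edgeClauses, Finset.mem_biUnion, Finset.mem_univ, true_and]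
    refine exists_congr fun u => exists_congr fun v => ?_
    by_cases h : G.Adj u v <;> simp [h, and_assoc]

lemma length_coloringCNF_le {n : ℕ} (hL : ∀ v, (L v).card ≤ n) :
    (coloringCNF G L f enc).length ≤
      Fintype.card V * 2 ^ k + Fintype.card V * (Fintype.card V * n) := by
  rw [coloringCNF, Finset.length_toList]
  refine (Finset.card_union_le _ _).trans (Nat.add_le_add ?_ ?_)
  · refine Finset.card_biUnion_le_card_mul _ _ _ fun v _ => ?_
    refine Finset.card_image_le.trans ((Finset.card_le_univ _).trans ?_)
    simp
  · refine Finset.card_biUnion_le_card_mul _ _ _ fun u _ => ?_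
    refine Finset.card_biUnion_le_card_mul _ _ _ fun v _ => ?_
    split_ifs
    · exact Finset.card_image_le.trans
        ((Finset.card_le_card Finset.inter_subset_left).trans (hL u))
    · simp

lemma clauseVars_subset_of_mem_coloringCNF {c : Clause} (hc : c ∈ coloringCNF G L f enc) :
    (∃ v, clauseVars c ⊆ block f v) ∨
      ∃ u v, G.Adj u v ∧ clauseVars c ⊆ block f u ∪ block f v := by
  rcases mem_coloringCNF.1 hc with ⟨v, t, -, rfl⟩ | ⟨u, v, a, h, -, -, rfl⟩
  · exact Or.inl ⟨v, (clauseVars_forbid _ _).subset⟩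
  · refine Or.inr ⟨u, v, h, ?_⟩
    rw [clauseVars_union, clauseVars_forbid, clauseVars_forbid]
    rfl

lemma card_cnfVars_coloringCNF_le :
    (cnfVars (coloringCNF G L f enc)).card ≤ Fintype.card V * k := by
  have h : cnfVars (coloringCNF G L f enc) ⊆ Finset.univ.image f := by
    intro x hx
    obtain ⟨c, hc, hxc⟩ := mem_cnfVars.1 hx
    have hblock : ∀ v, block f v ⊆ Finset.univ.image f := by
      intro v y hy
      obtain ⟨j, -, rfl⟩ := Finset.mem_image.1 hy
      exact Finset.mem_image_of_mem _ (Finset.mem_univ _)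
    rcases clauseVars_subset_of_mem_coloringCNF hc with ⟨v, hv⟩ | ⟨u, v, -, huv⟩
    · exact hblock v (hv hxc)
    · exact Finset.union_subset (hblock u) (hblock v) (huv hxc)
  refine (Finset.card_le_card h).trans (Finset.card_image_le.trans ?_)
  simp

lemma satisfiable_coloringCNF_iff (hf : Function.Injective f)
    (henc : ∀ v, Set.InjOn (enc v) (L v)) :
    Satisfiable (coloringCNF G L f enc) ↔
      ∃ c : V → ℕ, (∀ v, c v ∈ L v) ∧ ∀ u v, G.Adj u v → c u ≠ c v := by
  constructor
  · rintro ⟨τ, hτ⟩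
    have h : ∀ v, ∃ a ∈ L v, enc v a = fun j => τ (f (v, j)) := by
      intro v
      by_contra hv
      refine (satC_forbid τ (fun j => f (v, j)) _).1 (hτ _ (mem_coloringCNF.2 (Or.inl
        ⟨v, fun j => τ (f (v, j)), ?_, rfl⟩))) rfl
      simpa using hv
    choose c hcL hc using h
    refine ⟨c, hcL, fun u v huv heq => ?_⟩
    have hsat := hτ _ (mem_coloringCNF.2 (Or.inr
      ⟨u, v, c u, huv, hcL u, heq ▸ hcL v, rfl⟩))
    rw [satC_union, satC_forbid, satC_forbid] at hsat
    rcases hsat with h | h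
    · exact h (hc u).symm
    · exact h (heq ▸ (hc v).symm)
  · rintro ⟨c, hcL, hc⟩
    refine ⟨Function.extend f (fun q => enc q.1 (c q.1) q.2) fun _ => false, fun d hd => ?_⟩
    rcases mem_coloringCNF.1 hd with ⟨v, t, ht, rfl⟩ | ⟨u, v, a, huv, hau, hav, rfl⟩
    · rw [satC_forbid]
      simp only [hf.extend_apply]
      rintro rfl
      exact ht (Finset.mem_image_of_mem _ (hcL v))
    · rw [satC_union, satC_forbid, satC_forbid]
      simp only [hf.extend_apply]
      by_contra! h
      exact hc u v huv ((henc u (hcL u) hau h.1).trans (henc v (hcL v) hav h.2).symm)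

lemma pd_coloringCNF {p : ℕ} {Bs : List (Finset V)} (hf : Function.Injective f)
    (hB : GraphPD G p Bs) :
    PD (coloringCNF G L f enc) ((p + 1) * k)
      (Bs.map fun b => b.biUnion (block f) ∩ cnfVars (coloringCNF G L f enc)) := by
  obtain ⟨hcard, hvert, hedge, hint⟩ := hB
  have hclause : ∀ c ∈ coloringCNF G L f enc,
      ∃ b ∈ Bs, clauseVars c ⊆ b.biUnion (block f) ∩ cnfVars (coloringCNF G L f enc) := by
    intro c hc
    have hvars : clauseVars c ⊆ cnfVars (coloringCNF G L f enc) :=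
      fun x hx => mem_cnfVars.2 ⟨c, hc, hx⟩
    rcases clauseVars_subset_of_mem_coloringCNF hc with ⟨v, hv⟩ | ⟨u, v, huv, hsub⟩
    · obtain ⟨b, hb, hvb⟩ := hvert v
      exact ⟨b, hb, Finset.subset_inter
        (hv.trans (Finset.subset_biUnion_of_mem (block f) hvb)) hvars⟩
    · obtain ⟨b, hb, hub, hvb⟩ := hedge u v huv
      exact ⟨b, hb, Finset.subset_inter (hsub.trans (Finset.union_subset
        (Finset.subset_biUnion_of_mem (block f) hub)
        (Finset.subset_biUnion_of_mem (block f) hvb))) hvars⟩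
  have hgetD : ∀ i, (Bs.map fun b => b.biUnion (block f) ∩
      cnfVars (coloringCNF G L f enc)).getD i ∅ =
      (Bs.getD i ∅).biUnion (block f) ∩ cnfVars (coloringCNF G L f enc) := by
    intro i
    simpa using List.getD_map (n := i) Bs ∅
      (fun b : Finset V => b.biUnion (block f) ∩ cnfVars (coloringCNF G L f enc))
  refine ⟨⟨?_, ?_, ?_, ?_⟩, ?_⟩
  · simp only [List.forall_mem_map]
    exact fun b _ => Finset.inter_subset_right
  · intro x hx
    obtain ⟨c, hc, hxc⟩ := mem_cnfVars.1 hx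
    obtain ⟨b, hb, hcb⟩ := hclause c hc
    exact ⟨_, List.mem_map_of_mem hb, hcb hxc⟩
  · intro c hc
    obtain ⟨b, hb, hcb⟩ := hclause c hc
    exact ⟨_, List.mem_map_of_mem hb, hcb⟩
  · intro x i j l hij hjl hi hl
    rw [hgetD, Finset.mem_inter, Finset.mem_biUnion] at hi hl ⊢
    obtain ⟨⟨u, hu, hxu⟩, hx⟩ := hi
    obtain ⟨⟨v, hv, hxv⟩, -⟩ := hl
    have huv : u = v := by
      obtain ⟨a, -, ha⟩ := Finset.mem_image.1 hxu
      obtain ⟨b, -, hb⟩ := Finset.mem_image.1 hxv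
      exact congrArg Prod.fst (hf (ha.trans hb.symm))
    subst huv
    exact ⟨⟨u, hint u i j l hij hjl hu hv, hxu⟩, hx⟩
  · simp only [List.forall_mem_map]
    intro b hb
    have hblock : (b.biUnion (block f)).card ≤ b.card * k :=
      Finset.card_biUnion_le_card_mul _ _ _ fun v _ => Finset.card_image_le.trans (by simp)
    calc (b.biUnion (block f) ∩ cnfVars (coloringCNF G L f enc)).card
        ≤ (b.biUnion (block f)).card := Finset.card_le_card Finset.inter_subset_left
      _ ≤ (p + 1) * k := hblock.trans (Nat.mul_le_mul_right k (hcard b hb))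
      _ ≤ (p + 1) * k + 1 := Nat.le_succ _

end Coloring

/-- There is an absolute constant `C` such that: for every list coloring
instance on a simple graph `G` with `n ≥ 2` vertices in which every list has at most `n`
colors, and every path decomposition of `G` of width `p`, there is a CNF formula `ψ` with
at most `C·n³` variables and clauses, together with a path decomposition of width at most
`(p + 1)·⌈log₂ n⌉`, such that `ψ` is satisfiable iff the instance admits a proper list
coloring. -/
theorem stmt14 : ∃ C : ℕ, ∀ (V : Type) [Fintype V] [DecidableEq V],
    ∀ (G : SimpleGraph V) (L : V → Finset ℕ) (p : ℕ) (Bs : List (Finset V)),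
    2 ≤ Fintype.card V → (∀ v, (L v).card ≤ Fintype.card V) → GraphPD G p Bs →
    ∃ (ψ : CNF) (B' : List (Finset Var)),
      (cnfVars ψ).card ≤ C * Fintype.card V ^ 3 ∧
      ψ.length ≤ C * Fintype.card V ^ 3 ∧
      PD ψ ((p + 1) * Nat.clog 2 (Fintype.card V)) B' ∧
      (Satisfiable ψ ↔
        ∃ c : V → ℕ, (∀ v, c v ∈ L v) ∧ ∀ u v, G.Adj u v → c u ≠ c v) := by
  refine ⟨3, fun V _ _ G L p Bs hn hL hB => ?_⟩
  obtain ⟨f, hf⟩ := exists_injective_nat (V × Fin (Nat.clog 2 (Fintype.card V)))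
  choose enc henc using fun v => exists_injOn_bits (L v) (Nat.clog 2 (Fintype.card V))
    ((hL v).trans (Nat.le_pow_clog (by norm_num) _))
  refine ⟨coloringCNF G L f enc, _, ?_, ?_, pd_coloringCNF hf hB,
    satisfiable_coloringCNF_iff hf henc⟩
  · have hk : Nat.clog 2 (Fintype.card V) ≤ Fintype.card V :=
      Nat.clog_le_of_le_pow Nat.lt_two_pow_self.le
    refine card_cnfVars_coloringCNF_le.trans ((Nat.mul_le_mul_left _ hk).trans ?_)
    nlinarith [Nat.zero_le (Fintype.card V ^ 2), Nat.zero_le (Fintype.card V ^ 3)]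
  · refine (length_coloringCNF_le hL).trans
      ((Nat.add_le_add_right (Nat.mul_le_mul_left _ (two_pow_clog_le hn)) _).trans ?_)
    nlinarith [Nat.mul_le_mul_right (Fintype.card V ^ 2) hn]

end PPSETH
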